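/- Let n ≥ 1 and let S ⊆ ℤⁿ be a finite set such that gap_ε(S) = ∅ for every ε ∈ {-1,0,1}ⁿ with ε ≠ 0. Then |∂_e(S)| = Σ_{ε ∈ {-1,0,1}ⁿ, ε≠0} |P_ε(S)|. -/

import Mathlib

/-- The number of edges in the edge boundary of `S` in the graph `Gₙ`
(vertices `ℤⁿ`, edges between points at `ℓ∞`-distance 1), counted as the
number of ordered pairs `(u, v)` with `u ∈ S`, `v ∉ S`, `‖u - v‖_∞ = 1`. -/
noncomputable def edgeBoundaryCard (n : ℕ) (S : Set (Fin n → ℤ)) : ℕ :=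
  Set.ncard {p : (Fin n → ℤ) × (Fin n → ℤ) |
    p.1 ∈ S ∧ p.2 ∉ S ∧ p.1 ≠ p.2 ∧ ∀ i, |p.1 i - p.2 i| ≤ 1}

/-- `gap_ε(S) = {x ∈ ℤⁿ : x - ε ∈ S, x ∉ S, x + bε ∈ S for some b ≥ 1}`. -/
def gapSet (n : ℕ) (S : Set (Fin n → ℤ)) (ε : Fin n → ℤ) : Set (Fin n → ℤ) :=
  {x | x - ε ∈ S ∧ x ∉ S ∧ ∃ b : ℤ, 1 ≤ b ∧ x + b • ε ∈ S}

/-- `|P_ε(S)|`: the number of equivalence classes of `S` under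
`u ~ v ↔ u - v` is an integer multiple of `ε`. -/
noncomputable def projCard (n : ℕ) (S : Set (Fin n → ℤ)) (ε : Fin n → ℤ) : ℕ :=
  Set.ncard ((QuotientAddGroup.mk (s := AddSubgroup.zmultiples ε)) '' S)

/-- The finite set of directions `ε ∈ {-1,0,1}ⁿ`, `ε ≠ 0`. -/
def directions (n : ℕ) : Finset (Fin n → ℤ) :=
  (Fintype.piFinset fun _ : Fin n => ({-1, 0, 1} : Finset ℤ)).erase 0

theorem mem_directions_iff {n : ℕ} {ε : Fin n → ℤ} :
    ε ∈ directions n ↔ ε ≠ 0 ∧ ∀ i, |ε i| ≤ 1 := by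
  simp only [directions, Finset.mem_erase, Fintype.mem_piFinset, Finset.mem_insert,
    Finset.mem_singleton, abs_le]
  refine and_congr_right fun _ => forall_congr' fun i => ?_
  omega

/-- A finite set meets every line in direction `ε ≠ 0` through one of its points in a last point. -/
theorem exists_last_on_line {n : ℕ} {S : Set (Fin n → ℤ)} (hS : S.Finite) {ε : Fin n → ℤ}
    (hε : ε ≠ 0) {x : Fin n → ℤ} (hx : x ∈ S) :
    ∃ k : ℤ, x + k • ε ∈ S ∧ x + k • ε + ε ∉ S := by
  have hinj : Function.Injective fun k : ℤ => x + k • ε :=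
    (add_right_injective x).comp (smul_left_injective ℤ hε)
  have hfin : {k : ℤ | x + k • ε ∈ S}.Finite := hS.preimage hinj.injOn
  obtain ⟨k, hk, hmax⟩ := hfin.exists_maximal ⟨0, by simpa using hx⟩
  refine ⟨k, hk, fun h => ?_⟩
  have hk1 : k + 1 ≤ k := hmax (y := k + 1) (by
    change x + (k + 1) • ε ∈ S
    rwa [add_smul, one_smul, ← add_assoc]) (by simp)
  omega

/-- Without gaps in direction `ε`, each line in direction `ε` has at most one last point. -/
theorem last_on_line_le {n : ℕ} {S : Set (Fin n → ℤ)} {ε : Fin n → ℤ}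
    (hgap : gapSet n S ε = ∅) {x : Fin n → ℤ} {k : ℤ} (hx : x ∈ S) (hxε : x + ε ∉ S)
    (hk : x + k • ε ∈ S) : k ≤ 0 := by
  by_contra! hpos
  obtain rfl | hk2 : k = 1 ∨ 2 ≤ k := by omega
  · exact hxε (by simpa using hk)
  · have : x + ε ∈ gapSet n S ε := by
      refine ⟨by simpa using hx, hxε, k - 1, by omega, ?_⟩
      convert hk using 1
      module
    simp [hgap] at this

/-- Without gaps in direction `ε ≠ 0`, the lines in direction `ε` meeting `S` correspond to the
points of `S` whose translate by `ε` leaves `S`. -/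
theorem projCard_eq_ncard_of_gapSet_eq_empty {n : ℕ} {S : Set (Fin n → ℤ)} (hS : S.Finite)
    {ε : Fin n → ℤ} (hε : ε ≠ 0) (hgap : gapSet n S ε = ∅) :
    projCard n S ε = {x | x ∈ S ∧ x + ε ∉ S}.ncard := by
  have himage : (QuotientAddGroup.mk (s := AddSubgroup.zmultiples ε)) '' S =
      (QuotientAddGroup.mk (s := AddSubgroup.zmultiples ε)) '' {x | x ∈ S ∧ x + ε ∉ S} := by
    refine Set.Subset.antisymm ?_ (Set.image_mono fun x hx => hx.1)
    rintro _ ⟨x, hx, rfl⟩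
    obtain ⟨k, hk, hkε⟩ := exists_last_on_line hS hε hx
    refine ⟨x + k • ε, ⟨hk, hkε⟩, ?_⟩
    rw [eq_comm, QuotientAddGroup.eq, AddSubgroup.mem_zmultiples_iff]
    exact ⟨k, by module⟩
  rw [projCard, himage]
  refine Set.InjOn.ncard_image fun x hx y hy hxy => ?_
  rw [QuotientAddGroup.eq, AddSubgroup.mem_zmultiples_iff] at hxy
  obtain ⟨k, hk⟩ := hxy
  have hy' : y = x + k • ε := by rw [hk]; abel
  have hx' : x = y + (-k) • ε := by rw [hy']; module
  have h1 : k ≤ 0 := last_on_line_le hgap hx.1 hx.2 (hy' ▸ hy.1)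
  have h2 : -k ≤ 0 := last_on_line_le hgap hy.1 hy.2 (hx' ▸ hx.1)
  obtain rfl : k = 0 := by omega
  simpa using hy'.symm

/-- The edge boundary splits according to the direction of the edges. -/
theorem edgeBoundaryCard_eq_sum (n : ℕ) {S : Set (Fin n → ℤ)} (hS : S.Finite) :
    edgeBoundaryCard n S = ∑ ε ∈ directions n, {x | x ∈ S ∧ x + ε ∉ S}.ncard := by
  classical
  lift S to Finset (Fin n → ℤ) using hS
  have hboundary : {p : (Fin n → ℤ) × (Fin n → ℤ) |
      p.1 ∈ (S : Set (Fin n → ℤ)) ∧ p.2 ∉ (S : Set (Fin n → ℤ)) ∧ p.1 ≠ p.2 ∧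
        ∀ i, |p.1 i - p.2 i| ≤ 1} =
      ((directions n).biUnion fun ε =>
        {x ∈ S | x + ε ∉ S}.image fun x => (x, x + ε) : Finset _) := by
    ext ⟨u, v⟩
    simp only [Set.mem_ofPred_eq, SetLike.mem_coe, Finset.mem_biUnion, Finset.mem_image,
      Finset.mem_filter, Prod.mk.injEq, mem_directions_iff]
    constructor
    · rintro ⟨hu, hv, hne, hle⟩
      exact ⟨v - u, ⟨sub_ne_zero.2 hne.symm, fun i => by
        rw [Pi.sub_apply, abs_sub_comm]; exact hle i⟩, u, ⟨hu, by simpa using hv⟩, rfl, by simp⟩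
    · rintro ⟨ε, ⟨hε, hle⟩, _, ⟨hu, hv⟩, rfl, rfl⟩
      exact ⟨hu, hv, by simpa using hε, fun i => by simpa using hle i⟩
  rw [edgeBoundaryCard, hboundary, Set.ncard_coe_finset, Finset.card_biUnion]
  · refine Finset.sum_congr rfl fun ε _ => ?_
    rw [Finset.card_image_of_injective _ fun x y h => congrArg Prod.fst h,
      ← Set.ncard_coe_finset]
    simp
  · intro ε _ δ _ hne
    simp only [Function.onFun, Finset.disjoint_left, Finset.mem_image]
    rintro _ ⟨x, _, rfl⟩ ⟨y, _, h⟩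
    obtain ⟨rfl, h⟩ := Prod.mk.inj h
    exact hne (add_left_cancel h).symm

theorem edge_boundary_eq_sum_proj_of_no_gaps
    (n : ℕ) (hn : 1 ≤ n) (S : Set (Fin n → ℤ)) (hS : S.Finite)
    (hgap : ∀ ε ∈ directions n, gapSet n S ε = ∅) :
    edgeBoundaryCard n S = ∑ ε ∈ directions n, projCard n S ε := by
  rw [edgeBoundaryCard_eq_sum n hS]
  exact Finset.sum_congr rfl fun ε hε =>
    (projCard_eq_ncard_of_gapSet_eq_empty hS (mem_directions_iff.1 hε).1 (hgap ε hε)).symm
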